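/- Propagating enabling equivalence to the final T-net: let (N,μ₀) be a perpetual free-choice system with regeneration cluster cl, let (N̂ᵢ)_{i∈I} be a cl-adapted CP-exhaustion of N with final strongly connected T-net N̄ = N ∖ ⋃ᵢ N̂ᵢ, let (μ₁,μ₂) be reachable markings with en(N,μ₁) = en(N,μ₂), let σ be a global shutdown sequence with μⱼ →σ→ μ_{j,sd}, and set μ̄_{j,sd} = μ_{j,sd}|N̄ and cl̄ = N̄ ∩ cl. Then both markings μ̄_{1,sd} and μ̄_{2,sd} are reachable in the perpetual T-system (N̄, μ_cl̄), and en(N̄, μ̄_{1,sd}) = en(N̄, μ̄_{2,sd}). -/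

import Mathlib

open Classical

/-- A (finite, bipartite) Petri *net*: disjoint finite sets of places and
transitions, and an edge relation running only between places and transitions. -/
structure Net (α : Type*) where
  places : Finset α
  transitions : Finset α
  F : α → α → Prop
  disj : Disjoint places transitions
  edges : ∀ x y, F x y →
    (x ∈ places ∧ y ∈ transitions) ∨ (x ∈ transitions ∧ y ∈ places)

namespace Net

variable {α : Type*} [DecidableEq α]

/-- The nodes of a net. -/
def nodes (N : Net α) : Finset α := N.places ∪ N.transitions

/-- Pre-set of a node. -/
def pre (N : Net α) (x : α) : Set α := {y | N.F y x}

/-- Post-set of a node. -/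
def post (N : Net α) (x : α) : Set α := {y | N.F x y}

/-- A transition `t` is enabled at a marking `μ` if every pre-place is marked. -/
def Enabled (N : Net α) (μ : α → ℕ) (t : α) : Prop :=
  t ∈ N.transitions ∧ ∀ p, N.F p t → 1 ≤ μ p

/-- Firing a transition: remove one token from each pre-place,
add one token at each post-place. -/
noncomputable def fire (N : Net α) (t : α) (μ : α → ℕ) : α → ℕ :=
  fun p => μ p - (if N.F p t then 1 else 0) + (if N.F t p then 1 else 0)

/-- `FireSeq N μ σ ν`: the occurrence sequence `σ` is enabled at `μ` and
firing it successively leads from `μ` to `ν`. -/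
inductive FireSeq (N : Net α) : (α → ℕ) → List α → (α → ℕ) → Prop
  | nil (μ : α → ℕ) : FireSeq N μ [] μ
  | cons {μ ν : α → ℕ} {t : α} {σ : List α} :
      N.Enabled μ t → FireSeq N (N.fire t μ) σ ν → FireSeq N μ (t :: σ) ν

/-- Reachability of markings. -/
def Reach (N : Net α) (μ ν : α → ℕ) : Prop := ∃ σ : List α, N.FireSeq μ σ ν

/-- The set of transitions enabled at `μ`. -/
def en (N : Net α) (μ : α → ℕ) : Set α := {t | N.Enabled μ t}

/-- Equality of markings (as maps on the places of the net). -/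
def MarkingEq (N : Net α) (μ ν : α → ℕ) : Prop := ∀ p ∈ N.places, μ p = ν p

/-- Liveness of a Petri net `(N, μ₀)`. -/
def Live (N : Net α) (μ₀ : α → ℕ) : Prop :=
  ∀ t ∈ N.transitions, ∀ μ, N.Reach μ₀ μ → ∃ ν, N.Reach μ ν ∧ N.Enabled ν t

/-- Boundedness of a Petri net `(N, μ₀)`. -/
def Bounded (N : Net α) (μ₀ : α → ℕ) : Prop :=
  ∃ K : ℕ, ∀ μ, N.Reach μ₀ μ → ∀ p ∈ N.places, μ p ≤ K

/-- A net is well-formed if it carries a live and bounded marking. -/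
def WellFormed (N : Net α) : Prop := ∃ μ₀ : α → ℕ, N.Live μ₀ ∧ N.Bounded μ₀

/-- Free-choice net: `(p,t) ∈ F` implies `•t × p• ⊆ F`. -/
def FreeChoice (N : Net α) : Prop :=
  ∀ p ∈ N.places, ∀ t, N.F p t → ∀ p', N.F p' t → ∀ t', N.F p t' → N.F p' t'

/-- T-net: every place has exactly one pre-transition and one post-transition. -/
def IsTNet (N : Net α) : Prop :=
  ∀ p ∈ N.places, (∃! t, N.F t p) ∧ (∃! t, N.F p t)

/-- A set of nodes is cluster-closed if with each place it contains the
post-set of the place and with each transition the pre-set of the transition. -/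
def ClusterClosed (N : Net α) (S : Set α) : Prop :=
  (∀ p ∈ S, p ∈ N.places → ∀ t, N.F p t → t ∈ S) ∧
  (∀ t ∈ S, t ∈ N.transitions → ∀ p, N.F p t → p ∈ S)

/-- The cluster of a node: the smallest cluster-closed set of nodes containing it. -/
def clusterOf (N : Net α) (x : α) : Set α :=
  ⋂₀ {S : Set α | x ∈ S ∧ N.ClusterClosed S}

/-- `cl` is a cluster of `N` if it is the cluster of some node. -/
def IsCluster (N : Net α) (cl : Set α) : Prop :=
  ∃ x ∈ N.nodes, cl = N.clusterOf x

/-- The marking `μ_cl` marking exactly the places of the cluster `cl`, once. -/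
noncomputable def clusterMarking (N : Net α) (cl : Set α) : α → ℕ :=
  fun p => if p ∈ cl ∧ p ∈ N.places then 1 else 0

/-- `μh` is a home marking of `(N, μ₀)`: reachable from every reachable marking. -/
def IsHomeMarking (N : Net α) (μ₀ μh : α → ℕ) : Prop :=
  ∀ μ, N.Reach μ₀ μ → ∃ ν, N.Reach μ ν ∧ N.MarkingEq ν μh

/-- `(N, μ₀)` is perpetual with regeneration cluster `cl`: live, bounded, and
`μ_cl` is a home marking for the cluster `cl`. -/
def Perpetual (N : Net α) (μ₀ : α → ℕ) (cl : Set α) : Prop :=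
  N.Live μ₀ ∧ N.Bounded μ₀ ∧ N.IsCluster cl ∧
    N.IsHomeMarking μ₀ (N.clusterMarking cl)

/-- Lucency: enabling-equivalent reachable markings are equal. -/
def Lucent (N : Net α) (μ₀ : α → ℕ) : Prop :=
  ∀ μ₁ μ₂, N.Reach μ₀ μ₁ → N.Reach μ₀ μ₂ → N.en μ₁ = N.en μ₂ → N.MarkingEq μ₁ μ₂

/-- A path of the net: a nonempty sequence of nodes along edges. -/
def IsPath (N : Net α) (δ : List α) : Prop :=
  δ ≠ [] ∧ (∀ x ∈ δ, x ∈ N.nodes) ∧ δ.Chain' N.F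

/-- A circuit: a path whose last node is connected back to its first node. -/
def IsCircuit (N : Net α) (δ : List α) : Prop :=
  N.IsPath δ ∧ ∃ h : δ ≠ [], N.F (δ.getLast h) (δ.head h)

/-- Token count of a set of nodes: total number of tokens on its places. -/
def tokenCount (N : Net α) (μ : α → ℕ) (X : Finset α) : ℕ :=
  ∑ p ∈ X ∩ N.places, μ p

/-- The set `S` of nodes is strongly connected (in the induced subnet). -/
def StronglyConnectedOn (N : Net α) (S : Finset α) : Prop :=
  ∀ x ∈ S, ∀ y ∈ S,
    Relation.ReflTransGen (fun a b => a ∈ S ∧ b ∈ S ∧ N.F a b) x y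

/-- The set `S` of nodes is weakly connected (in the induced subnet). -/
def WeaklyConnectedOn (N : Net α) (S : Finset α) : Prop :=
  ∀ x ∈ S, ∀ y ∈ S,
    Relation.ReflTransGen (fun a b => a ∈ S ∧ b ∈ S ∧ (N.F a b ∨ N.F b a)) x y

/-- The (full) subnet spanned by `S` is transition-bordered: every place of `S`
has all its neighbours inside `S`. -/
def TransitionBordered (N : Net α) (S : Finset α) : Prop :=
  ∀ p ∈ S, p ∈ N.places → ∀ y, (N.F y p ∨ N.F p y) → y ∈ S

/-- The full subnet spanned by `S` is a T-net: each place of `S` has exactly one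
pre-transition and one post-transition inside `S`. -/
def TNetOn (N : Net α) (S : Finset α) : Prop :=
  ∀ p ∈ S, p ∈ N.places →
    (∃! t, t ∈ S ∧ N.F t p) ∧ (∃! t, t ∈ S ∧ N.F p t)

/-- `S` spans a CP-subnet of `N`: nonempty, weakly connected, transition-bordered,
a T-net, and the complement contains a transition and is strongly connected. -/
def IsCPSubnet (N : Net α) (S : Finset α) : Prop :=
  S.Nonempty ∧ S ⊆ N.nodes ∧ N.WeaklyConnectedOn S ∧ N.TransitionBordered S ∧
  N.TNetOn S ∧ ((N.nodes \ S) ∩ N.transitions).Nonempty ∧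
  N.StronglyConnectedOn (N.nodes \ S)

/-- The full subnet of `N` spanned by the node set `S`, as a net. -/
def restrict (N : Net α) (S : Finset α) : Net α where
  places := N.places ∩ S
  transitions := N.transitions ∩ S
  F := fun x y => x ∈ S ∧ y ∈ S ∧ N.F x y
  disj := N.disj.mono Finset.inter_subset_left Finset.inter_subset_left
  edges := by
    rintro x y ⟨hx, hy, hF⟩
    rcases N.edges x y hF with ⟨h1, h2⟩ | ⟨h1, h2⟩
    · exact Or.inl ⟨Finset.mem_inter.mpr ⟨h1, hx⟩, Finset.mem_inter.mpr ⟨h2, hy⟩⟩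
    · exact Or.inr ⟨Finset.mem_inter.mpr ⟨h1, hx⟩, Finset.mem_inter.mpr ⟨h2, hy⟩⟩

/-- A CP-exhaustion: a family of pairwise disjoint CP-subnets whose complement
is a strongly connected T-net. -/
def IsCPExhaustion (N : Net α) {n : ℕ}
    (Nhat : Fin n → Finset α) : Prop :=
  (∀ i, N.IsCPSubnet (Nhat i)) ∧
  (∀ i j, i ≠ j → Disjoint (Nhat i) (Nhat j)) ∧
  N.StronglyConnectedOn (N.nodes \ Finset.univ.biUnion Nhat) ∧
  N.TNetOn (N.nodes \ Finset.univ.biUnion Nhat)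

/-- `t` is a way-in transition of the subnet spanned by `S`: a transition of `S`
with a pre-place outside `S`. -/
def IsWayIn (N : Net α) (S : Finset α) (t : α) : Prop :=
  t ∈ S ∧ t ∈ N.transitions ∧ ∃ p ∈ N.places, p ∉ S ∧ N.F p t

/-- A shutdown sequence for the subnet spanned by `S` (with way-in transition
`tin`) at a marking `μ`: an occurrence sequence enabled at `μ` using only
transitions of `S` other than `tin`, after which no transition of `S` other
than (possibly) `tin` is enabled. -/
def IsShutdownSeq (N : Net α) (S : Finset α) (tin : α)
    (μ : α → ℕ) (σ : List α) (μsd : α → ℕ) : Prop :=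
  N.FireSeq μ σ μsd ∧
  (∀ t ∈ σ, t ∈ S ∧ t ∈ N.transitions ∧ t ≠ tin) ∧
  (∀ t ∈ S, t ∈ N.transitions → t ≠ tin → ¬ N.Enabled μsd t)

/-- `C` spans a P-component of `N`: nonempty, strongly connected, inside `C`
every transition has exactly one pre-place and one post-place, and every place
of `C` has all its neighbours inside `C`. -/
def IsPComponent (N : Net α) (C : Finset α) : Prop :=
  C.Nonempty ∧ C ⊆ N.nodes ∧ N.StronglyConnectedOn C ∧
  (∀ t ∈ C, t ∈ N.transitions →
    (∃! p, p ∈ C ∧ N.F p t) ∧ (∃! p, p ∈ C ∧ N.F t p)) ∧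
  (∀ p ∈ C, p ∈ N.places → ∀ y, (N.F y p ∨ N.F p y) → y ∈ C)

end Net
namespace Net

variable {α : Type*} {N : Net α}

/-! ### Edges and occurrence sequences -/

theorem place_of_edge_transition {p t : α} (h : N.F p t) (ht : t ∈ N.transitions) :
    p ∈ N.places := by
  rcases N.edges _ _ h with h | h
  · exact h.1
  · exact absurd ht (Finset.disjoint_left.mp N.disj h.2)

theorem place_of_transition_edge {p t : α} (h : N.F t p) (ht : t ∈ N.transitions) :
    p ∈ N.places := by
  rcases N.edges _ _ h with h | h
  · exact absurd ht (Finset.disjoint_left.mp N.disj h.1)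
  · exact h.2

theorem transition_of_edge_place {p t : α} (h : N.F t p) (hp : p ∈ N.places) :
    t ∈ N.transitions := by
  rcases N.edges _ _ h with h | h
  · exact absurd h.2 (Finset.disjoint_left.mp N.disj hp)
  · exact h.1

theorem transition_of_place_edge {p t : α} (h : N.F p t) (hp : p ∈ N.places) :
    t ∈ N.transitions := by
  rcases N.edges _ _ h with h | h
  · exact h.2
  · exact absurd h.1 (Finset.disjoint_left.mp N.disj hp)

theorem FireSeq.append {μ ν ρ : α → ℕ} {σ τ : List α} (h : N.FireSeq μ σ ν)
    (h' : N.FireSeq ν τ ρ) : N.FireSeq μ (σ ++ τ) ρ := by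
  induction h with
  | nil => exact h'
  | cons he _ ih => exact FireSeq.cons he (ih h')

theorem FireSeq.single {μ : α → ℕ} {t : α} (h : N.Enabled μ t) :
    N.FireSeq μ [t] (N.fire t μ) :=
  FireSeq.cons h (FireSeq.nil _)

theorem FireSeq.reach {μ ν : α → ℕ} {σ : List α} (h : N.FireSeq μ σ ν) : N.Reach μ ν :=
  ⟨σ, h⟩

theorem Reach.refl (μ : α → ℕ) : N.Reach μ μ := ⟨[], FireSeq.nil _⟩

theorem Reach.trans {μ ν ρ : α → ℕ} (h : N.Reach μ ν) (h' : N.Reach ν ρ) : N.Reach μ ρ := by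
  obtain ⟨σ, h⟩ := h
  obtain ⟨τ, h'⟩ := h'
  exact ⟨_, h.append h'⟩

theorem FireSeq.mem_transitions {μ ν : α → ℕ} {σ : List α} (h : N.FireSeq μ σ ν) :
    ∀ t ∈ σ, t ∈ N.transitions := by
  induction h with
  | nil => simp
  | cons he _ ih =>
    intro t ht
    rcases List.mem_cons.mp ht with rfl | ht
    · exact he.1
    · exact ih t ht

/-- Every transition of an occurrence sequence is enabled after some prefix of it. -/
theorem FireSeq.exists_enabled_of_mem {μ ν : α → ℕ} {σ : List α} (h : N.FireSeq μ σ ν)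
    {t : α} (ht : t ∈ σ) :
    ∃ τ ρ, N.FireSeq μ τ ρ ∧ N.Enabled ρ t ∧ ∀ u ∈ τ, u ∈ σ := by
  induction h with
  | nil => simp at ht
  | @cons μ ν u σ he _ ih =>
    rcases List.mem_cons.mp ht with rfl | ht
    · exact ⟨[], μ, FireSeq.nil _, he, by simp⟩
    · obtain ⟨τ, ρ, h1, h2, h3⟩ := ih ht
      refine ⟨u :: τ, ρ, FireSeq.cons he h1, h2, ?_⟩
      intro v hv
      rcases List.mem_cons.mp hv with rfl | hv
      · exact List.mem_cons_self
      · exact List.mem_cons_of_mem _ (h3 v hv)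

theorem Live.of_reach {μ ν : α → ℕ} (h : N.Live μ) (hr : N.Reach μ ν) : N.Live ν :=
  fun t ht ρ hρ => h t ht ρ (hr.trans hρ)

theorem Live.exists_enabled {μ : α → ℕ} (h : N.Live μ) {t : α} (ht : t ∈ N.transitions) :
    ∃ u, N.Enabled μ u := by
  obtain ⟨ν, ⟨σ, hσ⟩, hν⟩ := h t ht μ (Reach.refl _)
  cases hσ with
  | nil => exact ⟨t, hν⟩
  | cons he _ => exact ⟨_, he⟩

theorem MarkingEq.symm {μ ν : α → ℕ} (h : N.MarkingEq μ ν) : N.MarkingEq ν μ :=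
  fun p hp => (h p hp).symm

theorem MarkingEq.enabled {μ ν : α → ℕ} (h : N.MarkingEq μ ν) {t : α} (ht : N.Enabled μ t) :
    N.Enabled ν t :=
  ⟨ht.1, fun p hp => h p (place_of_edge_transition hp ht.1) ▸ ht.2 p hp⟩

theorem FireSeq.congr {μ ν μ' : α → ℕ} {σ : List α} (h : N.FireSeq μ σ ν)
    (he : N.MarkingEq μ μ') : ∃ ν', N.FireSeq μ' σ ν' ∧ N.MarkingEq ν ν' := by
  induction h generalizing μ' with
  | nil => exact ⟨μ', FireSeq.nil _, he⟩
  | @cons μ ν t σ ht _ ih =>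
    obtain ⟨ν', h1, h2⟩ := ih (μ' := N.fire t μ')
      (fun p hp => by simp only [fire, he p hp])
    exact ⟨ν', FireSeq.cons (he.enabled ht) h1, h2⟩

theorem Live.congr {μ μ' : α → ℕ} (h : N.Live μ) (he : N.MarkingEq μ μ') : N.Live μ' := by
  intro t ht ν ⟨σ, hσ⟩
  obtain ⟨ν', h1, h2⟩ := hσ.congr he.symm
  obtain ⟨ρ, ⟨τ, hτ⟩, hρ⟩ := h t ht ν' ⟨σ, h1⟩
  obtain ⟨ρ', h3, h4⟩ := hτ.congr h2.symm
  exact ⟨ρ', ⟨τ, h3⟩, h4.enabled hρ⟩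

/-- All markings reachable from `μ` are bounded by `K`. -/
def BoundedBy (N : Net α) (K : ℕ) (μ : α → ℕ) : Prop :=
  ∀ ν, N.Reach μ ν → ∀ p ∈ N.places, ν p ≤ K

theorem BoundedBy.of_reach {K : ℕ} {μ ν : α → ℕ} (h : N.BoundedBy K μ) (hr : N.Reach μ ν) :
    N.BoundedBy K ν :=
  fun ρ hρ => h ρ (hr.trans hρ)

theorem BoundedBy.congr {K : ℕ} {μ μ' : α → ℕ} (h : N.BoundedBy K μ) (he : N.MarkingEq μ μ') :
    N.BoundedBy K μ' := by
  intro ν ⟨σ, hσ⟩ p hp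
  obtain ⟨ν', h1, h2⟩ := hσ.congr he.symm
  exact h2 p hp ▸ h ν' ⟨σ, h1⟩ p hp

/-- In a live system there is no nonempty set of transitions each of which waits for an
unmarked place fed only by the set itself. -/
theorem Live.exists_forall_marked_or_fed {μ : α → ℕ} (h : N.Live μ) {V : Set α}
    (hV : ∀ t ∈ V, t ∈ N.transitions) {t₀ : α} (h₀ : t₀ ∈ V) :
    ∃ t ∈ V, ∀ p, N.F p t → μ p = 0 → ∃ a, N.F a p ∧ a ∉ V := by
  by_contra! hcon
  have key : ∀ {μ σ ν}, N.FireSeq μ σ ν →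
      (∀ t ∈ V, ∃ p, N.F p t ∧ μ p = 0 ∧ ∀ a, N.F a p → a ∈ V) →
      ∀ t ∈ V, ∃ p, N.F p t ∧ ν p = 0 ∧ ∀ a, N.F a p → a ∈ V := by
    intro μ σ ν hσ
    induction hσ with
    | nil => exact id
    | @cons μ ν u σ hu _ ih =>
      intro hμ
      apply ih
      intro t ht
      obtain ⟨p, h1, h2, h3⟩ := hμ t ht
      refine ⟨p, h1, ?_, h3⟩
      have : ¬ N.F u p := by
        intro hup
        obtain ⟨q, hq1, hq2, -⟩ := hμ u (h3 u hup)
        have := hu.2 q hq1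
        omega
      simp [fire, this, h2]
  obtain ⟨ν, ⟨σ, hσ⟩, hν⟩ := h t₀ (hV _ h₀) μ (Reach.refl _)
  obtain ⟨p, h1, h2, -⟩ := key hσ hcon t₀ h₀
  have := hν.2 p h1
  omega

/-- A transitive relation that is serial on a set of uniformly bounded markings relates
two markings that coincide on all places. -/
theorem exists_rel_markingEq {Inv : (α → ℕ) → Prop} {R : (α → ℕ) → (α → ℕ) → Prop}
    (htr : ∀ a b c, R a b → R b c → R a c) {K : ℕ}
    (hb : ∀ a, Inv a → ∀ p ∈ N.places, a p ≤ K)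
    (hs : ∀ a, Inv a → ∃ b, Inv b ∧ R a b) {a₀ : α → ℕ} (h₀ : Inv a₀) :
    ∃ a b, Inv a ∧ R a b ∧ N.MarkingEq a b := by
  choose! g hg1 hg2 using hs
  let f : ℕ → (α → ℕ) := fun k => g^[k] a₀
  have hf : ∀ k, Inv (f k) := by
    intro k
    induction k with
    | zero => exact h₀
    | succ k ih => simpa only [f, Function.iterate_succ_apply'] using hg1 _ ih
  have hR : ∀ k, R (f k) (f (k + 1)) := by
    intro k
    simpa only [f, Function.iterate_succ_apply'] using hg2 _ (hf k)
  have hlt : ∀ i j, i < j → R (f i) (f j) := by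
    intro i j hij
    induction j, hij using Nat.le_induction with
    | base => exact hR i
    | succ j _ ih => exact htr _ _ _ ih (hR j)
  let e : ℕ → (N.places → Fin (K + 1)) := fun k p =>
    ⟨f k p, Nat.lt_succ_of_le (hb _ (hf k) p p.2)⟩
  obtain ⟨i, j, hij, he⟩ := Finite.exists_ne_map_eq_of_infinite e
  have heq : N.MarkingEq (f i) (f j) := fun p hp => by
    simpa [e] using congrFun he ⟨p, hp⟩
  rcases lt_or_gt_of_ne hij with h | h
  · exact ⟨_, _, hf i, hlt _ _ h, heq⟩
  · exact ⟨_, _, hf j, hlt _ _ h, heq.symm⟩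

/-! ### The state equation -/

/-- The change of marking at `p` caused by the firing vector `x`. -/
noncomputable def flow (N : Net α) (x : α → ℚ) (p : α) : ℚ :=
  ∑ t ∈ N.transitions,
    x t * ((if N.F t p then 1 else 0) - (if N.F p t then 1 else 0))

theorem cast_fire {μ : α → ℕ} {t : α} (h : N.Enabled μ t) (p : α) :
    (N.fire t μ p : ℚ) =
      μ p + ((if N.F t p then 1 else 0) - (if N.F p t then 1 else 0)) := by
  have h1 : (if N.F p t then 1 else 0) ≤ μ p := by
    split_ifs with hp
    · exact h.2 p hp
    · exact Nat.zero_le _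
  simp only [fire]
  push_cast [Nat.cast_sub h1]
  ring

theorem FireSeq.state_equation [DecidableEq α] {μ ν : α → ℕ} {σ : List α}
    (h : N.FireSeq μ σ ν) (p : α) :
    (ν p : ℚ) = μ p + N.flow (fun t => (σ.count t : ℚ)) p := by
  induction h with
  | nil => simp [flow]
  | @cons μ ν t σ he _ ih =>
    have : N.flow (fun u => ((t :: σ).count u : ℚ)) p =
        N.flow (fun u => (σ.count u : ℚ)) p +
          ((if N.F t p then 1 else 0) - (if N.F p t then 1 else 0)) := by
      simp only [flow, List.count_cons, Nat.cast_add, add_mul, Finset.sum_add_distrib]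
      congr 1
      rw [Finset.sum_eq_single t]
      · simp
      · intro u _ hu
        simp [Ne.symm hu]
      · exact fun hn => absurd he.1 hn
    rw [ih, cast_fire he, this]
    ring

theorem flow_eq_sub {x : α → ℚ} {p a b : α} (hp : p ∈ N.places) (ha : N.F a p) (hb : N.F p b)
    (ha' : ∀ t, N.F t p → x t ≠ 0 → t = a) (hb' : ∀ t, N.F p t → x t ≠ 0 → t = b) :
    N.flow x p = x a - x b := by
  simp only [flow, mul_sub, Finset.sum_sub_distrib]
  congr 1
  · rw [Finset.sum_eq_single a]
    · simp [ha]
    · intro t _ hta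
      by_cases h : N.F t p
      · have : x t = 0 := by
          by_contra hx
          exact hta (ha' t h hx)
        simp [this]
      · simp [h]
    · exact fun h => absurd (transition_of_edge_place ha hp) h
  · rw [Finset.sum_eq_single b]
    · simp [hb]
    · intro t _ htb
      by_cases h : N.F p t
      · have : x t = 0 := by
          by_contra hx
          exact htb (hb' t h hx)
        simp [this]
      · simp [h]
    · exact fun h => absurd (transition_of_place_edge hb hp) h

theorem flow_sub (x y : α → ℚ) (p : α) :
    N.flow (fun t => x t - y t) p = N.flow x p - N.flow y p := by
  simp only [flow, sub_mul, Finset.sum_sub_distrib]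

theorem flow_sum_mul {ι : Type*} (s : Finset ι) (c : ι → ℚ) (y : ι → α → ℚ) (p : α) :
    N.flow (fun t => ∑ i ∈ s, c i * y i t) p = ∑ i ∈ s, c i * N.flow (y i) p := by
  simp only [flow, Finset.sum_mul, Finset.mul_sum]
  rw [Finset.sum_comm]
  exact Finset.sum_congr rfl fun i _ => Finset.sum_congr rfl fun t _ => by ring

/-! ### Connectivity -/

theorem StronglyConnectedOn.weaklyConnectedOn {S : Finset α} (h : N.StronglyConnectedOn S) :
    N.WeaklyConnectedOn S :=
  fun x hx y hy => Relation.ReflTransGen.mono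
    (fun _ _ hab => ⟨hab.1, hab.2.1, Or.inl hab.2.2⟩) _ _ (h x hx y hy)

/-- A function that agrees on the two transitions adjacent to each place of a weakly
connected T-net is constant on its transitions. -/
theorem WeaklyConnectedOn.const {β : Type*} {S : Finset α} (hS : N.WeaklyConnectedOn S)
    (hT : N.TNetOn S) {f : α → β}
    (h : ∀ p ∈ S, p ∈ N.places → ∀ a ∈ S, ∀ b ∈ S, N.F a p → N.F p b → f a = f b)
    {t u : α} (ht : t ∈ S) (ht' : t ∈ N.transitions) (hu : u ∈ S) (hu' : u ∈ N.transitions) :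
    f u = f t := by
  have key : ∀ y, Relation.ReflTransGen
      (fun a b => a ∈ S ∧ b ∈ S ∧ (N.F a b ∨ N.F b a)) t y →
      (y ∈ N.transitions → f y = f t) ∧
      (y ∈ N.places → ∀ a ∈ S, (N.F a y ∨ N.F y a) → f a = f t) := by
    intro y hy
    induction hy with
    | refl => exact ⟨fun _ => rfl, fun hp => absurd ht' (Finset.disjoint_left.mp N.disj hp)⟩
    | @tail y z _ hyz ih =>
      obtain ⟨hy, hz, hF⟩ := hyz
      constructor
      · intro hzt
        have hyp : y ∈ N.places := by
          rcases hF with hF | hF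
          · exact place_of_edge_transition hF hzt
          · exact place_of_transition_edge hF hzt
        exact ih.2 hyp z hz hF.symm
      · intro hzp a ha haz
        have hyt : y ∈ N.transitions := by
          rcases hF with hF | hF
          · exact transition_of_edge_place hF hzp
          · exact transition_of_place_edge hF hzp
        have hfy := ih.1 hyt
        obtain ⟨⟨a₀, ⟨ha₀, ha₀'⟩, hua⟩, ⟨b₀, ⟨hb₀, hb₀'⟩, hub⟩⟩ := hT z hz hzp
        have hab := h z hz hzp a₀ ha₀ b₀ hb₀ ha₀' hb₀'
        have hadj : ∀ c ∈ S, (N.F c z ∨ N.F z c) → f c = f a₀ := by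
          rintro c hc (hc' | hc')
          · rw [hua c ⟨hc, hc'⟩]
          · rw [hub c ⟨hc, hc'⟩, hab]
        rw [hadj a ha haz, ← hadj y hy hF, hfy]
  exact (key u (hS t ht u hu)).1 hu'

theorem StronglyConnectedOn.of_succ_closed {S : Finset α} (hS : N.StronglyConnectedOn S)
    {V : α → Prop} (h : ∀ t ∈ S, t ∈ N.transitions → V t → ∀ p ∈ S, N.F t p →
      ∀ u ∈ S, N.F p u → V u)
    {t u : α} (ht : t ∈ S) (ht' : t ∈ N.transitions) (hu : u ∈ S) (hu' : u ∈ N.transitions)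
    (hV : V t) : V u := by
  have key : ∀ y, Relation.ReflTransGen (fun a b => a ∈ S ∧ b ∈ S ∧ N.F a b) t y →
      (y ∈ N.transitions → V y) ∧ (y ∈ N.places → ∀ a ∈ S, N.F y a → V a) := by
    intro y hy
    induction hy with
    | refl => exact ⟨fun _ => hV, fun hp => absurd ht' (Finset.disjoint_left.mp N.disj hp)⟩
    | @tail y z _ hyz ih =>
      obtain ⟨hy, hz, hF⟩ := hyz
      exact ⟨fun hzt => ih.2 (place_of_edge_transition hF hzt) z hz hF,
        fun hzp a ha haz => h y hy (transition_of_edge_place hF hzp)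
          (ih.1 (transition_of_edge_place hF hzp)) z hz hF a ha haz⟩
  exact (key u (hS t ht u hu)).1 hu'

theorem StronglyConnectedOn.of_pred_closed {S : Finset α} (hS : N.StronglyConnectedOn S)
    {V : α → Prop} (h : ∀ u ∈ S, V u → ∀ p ∈ S, N.F p u →
      ∀ t ∈ S, t ∈ N.transitions → N.F t p → V t)
    {t u : α} (ht : t ∈ S) (ht' : t ∈ N.transitions) (hu : u ∈ S) (hu' : u ∈ N.transitions)
    (hV : V t) : V u := by
  by_contra hVu
  exact hS.of_succ_closed (V := fun a => ¬ V a)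
    (fun a ha ha' hVa p hp hap b hb hpb hVb => hVa (h b hb hVb p hp hpb a ha ha' hap))
    hu hu' ht ht' hVu hV

/-! ### Live T-systems -/

/-- In a live T-system, every nonnegative solution of the state equation is realizable. -/
theorem IsTNet.reach_of_state_equation {M : Net α} (hM : M.IsTNet) {m m' y : α → ℕ}
    (hl : M.Live m)
    (hy : ∀ p ∈ M.places, ∀ a b, M.F a p → M.F p b → (m' p : ℤ) = m p + y a - y b) :
    ∃ ν, M.Reach m ν ∧ M.MarkingEq ν m' := by
  induction hk : ∑ t ∈ M.transitions, y t generalizing m y with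
  | zero =>
    refine ⟨m, Reach.refl _, fun p hp => ?_⟩
    obtain ⟨⟨a, ha, -⟩, ⟨b, hb, -⟩⟩ := hM p hp
    have h0 := Finset.sum_eq_zero_iff.mp hk
    have := hy p hp a b ha hb
    rw [h0 a (transition_of_edge_place ha hp), h0 b (transition_of_place_edge hb hp)] at this
    omega
  | succ k ih =>
    obtain ⟨t₀, ht₀, ht₀'⟩ : ∃ t ∈ M.transitions, 0 < y t := by
      by_contra! hcon
      have : ∑ t ∈ M.transitions, y t = 0 :=
        Finset.sum_eq_zero fun t ht => Nat.le_zero.mp (hcon t ht)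
      omega
    obtain ⟨t, ⟨ht, hty⟩, hpre⟩ := hl.exists_forall_marked_or_fed
      (V := {t | t ∈ M.transitions ∧ 0 < y t}) (fun t ht => ht.1) ⟨ht₀, ht₀'⟩
    have hen : M.Enabled m t := by
      refine ⟨ht, fun p hp => ?_⟩
      by_contra h0
      obtain ⟨a, ha, haV⟩ := hpre p hp (by omega)
      have hpp := place_of_edge_transition hp ht
      have hya : y a = 0 := by
        by_contra hne
        exact haV ⟨transition_of_edge_place ha hpp, Nat.pos_of_ne_zero hne⟩
      have := hy p hpp a t ha hp
      omega
    obtain ⟨ν, h1, h2⟩ := ih (m := M.fire t m) (y := Function.update y t (y t - 1))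
      (hl.of_reach (FireSeq.single hen).reach) (by
        intro p hp a b ha hb
        have hb' : M.F p t → b = t := fun h => (hM p hp).2.unique hb h
        have ha' : M.F t p → a = t := fun h => (hM p hp).1.unique ha h
        have e := hy p hp a b ha hb
        have hpos := hen.2 p
        by_cases h1 : M.F p t <;> by_cases h2 : M.F t p
        · obtain rfl := hb' h1
          obtain rfl := ha' h2
          have := hpos h1
          simp [fire, h1, h2]
          omega
        · obtain rfl := hb' h1
          have hab : a ≠ b := fun h => h2 (h ▸ ha)
          have := hpos h1
          simp [fire, h1, h2, hab]
          omega
        · obtain rfl := ha' h2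
          have hab : b ≠ a := fun h => h1 (h ▸ hb)
          simp [fire, h1, h2, hab]
          omega
        · have hat : a ≠ t := fun h => h2 (h ▸ ha)
          have hbt : b ≠ t := fun h => h1 (h ▸ hb)
          simp [fire, h1, h2, hat, hbt]
          omega) (by
        have e1 := Finset.add_sum_erase M.transitions y ht
        have e2 := Finset.add_sum_erase M.transitions (Function.update y t (y t - 1)) ht
        have e3 : ∑ u ∈ M.transitions.erase t, Function.update y t (y t - 1) u =
            ∑ u ∈ M.transitions.erase t, y u :=
          Finset.sum_congr rfl fun u hu => by simp [Finset.ne_of_mem_erase hu]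
        simp only [Function.update_self] at e2
        omega)
    exact ⟨ν, (FireSeq.single hen).reach.trans h1, h2⟩

/-! ### Clusters of free-choice nets -/

/-- The pre-set of `t` together with all transitions having the same pre-set. -/
def freeChoiceCluster (N : Net α) (t : α) : Set α :=
  {x | N.F x t ∨ (x ∈ N.transitions ∧ ∀ q, N.F q x ↔ N.F q t)}

theorem FreeChoice.clusterOf_eq (hfc : N.FreeChoice) {p t x : α} (hp : N.F p t)
    (ht : t ∈ N.transitions) (hx : x ∈ N.freeChoiceCluster t) :
    N.clusterOf x = N.freeChoiceCluster t := by
  apply Set.Subset.antisymm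
  · refine Set.sInter_subset_of_mem ⟨hx, ?_, ?_⟩
    · rintro q (hq | hq) hq' u hu
      · exact Or.inr ⟨transition_of_place_edge hu hq',
          fun s => ⟨fun hs => hfc q hq' u hu s hs t hq, fun hs => hfc q hq' t hq s hs u hu⟩⟩
      · exact absurd hq.1 (Finset.disjoint_left.mp N.disj hq')
    · rintro u (hu | hu) hu' q hq
      · exact absurd hu' (Finset.disjoint_left.mp N.disj (place_of_edge_transition hu ht))
      · exact Or.inl ((hu.2 q).mp hq)
  · rintro y hy U ⟨hxU, hU1, hU2⟩
    have htU : t ∈ U := by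
      rcases hx with hx | hx
      · exact hU1 x hxU (place_of_edge_transition hx ht) t hx
      · have hpU := hU2 x hxU hx.1 p ((hx.2 p).mpr hp)
        exact hU1 p hpU (place_of_edge_transition hp ht) t hp
    rcases hy with hy | hy
    · exact hU2 t htU ht y hy
    · exact hU1 p (hU2 t htU ht p hp) (place_of_edge_transition hp ht) y ((hy.2 p).mpr hp)

end Net

namespace Net

variable {α : Type*} [DecidableEq α] {N : Net α}

/-! ### Nets exhausted by CP-subnets -/

/-- The nodes of `N` are split into a strongly connected T-net `S` and pairwise disjoint
transition-bordered T-nets `H i` with way-in transitions `tin i`. -/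
structure Exhaustion (N : Net α) {n : ℕ} (H : Fin (n + 1) → Finset α)
    (tin : Fin (n + 1) → α) (S : Finset α) : Prop where
  fc : N.FreeChoice
  cover : ∀ x ∈ N.nodes, x ∈ S ∨ ∃ i, x ∈ H i
  notMem : ∀ i, ∀ x ∈ H i, x ∉ S
  disj : ∀ i j, i ≠ j → Disjoint (H i) (H j)
  wc : ∀ i, N.WeaklyConnectedOn (H i)
  bordered : ∀ i, N.TransitionBordered (H i)
  tnet : ∀ i, N.TNetOn (H i)
  sc : N.StronglyConnectedOn S
  tnetS : N.TNetOn S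
  wayIn : ∀ i, N.IsWayIn (H i) (tin i)

/-- A transition outside `S` none of whose pre-places belongs to `S`. -/
def Inner (N : Net α) (S : Finset α) (t : α) : Prop :=
  t ∈ N.transitions ∧ t ∉ S ∧ ∀ p, N.F p t → p ∉ S

/-- No inner transition is enabled. -/
def Quiet (N : Net α) (S : Finset α) (m : α → ℕ) : Prop :=
  ∀ t, N.Inner S t → ¬ N.Enabled m t

theorem mem_nodes_of_place {p : α} (h : p ∈ N.places) : p ∈ N.nodes :=
  Finset.mem_union_left _ h

theorem mem_nodes_of_transition {t : α} (h : t ∈ N.transitions) : t ∈ N.nodes :=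
  Finset.mem_union_right _ h

theorem flow_nonneg {S : Finset α} {x : α → ℚ} (hx : ∀ t, 0 ≤ x t)
    (hin : ∀ t, x t ≠ 0 → N.Inner S t) {p : α} (hp : p ∈ S) : 0 ≤ N.flow x p := by
  refine Finset.sum_nonneg fun t _ => ?_
  by_cases h : x t = 0
  · simp [h]
  · have : ¬ N.F p t := fun hF => (hin t h).2.2 p hF hp
    rw [if_neg this, sub_zero]
    exact mul_nonneg (hx t) (by split_ifs <;> norm_num)

namespace Exhaustion

variable {n : ℕ} {H : Fin (n + 1) → Finset α} {tin : Fin (n + 1) → α} {S : Finset α}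

theorem eq_of_mem (E : N.Exhaustion H tin S) {i j : Fin (n + 1)} {x : α} (hi : x ∈ H i)
    (hj : x ∈ H j) : i = j := by
  by_contra hne
  exact Finset.disjoint_left.mp (E.disj i j hne) hi hj

theorem place_mem (E : N.Exhaustion H tin S) {p t : α} (ht : t ∈ S) (hp : p ∈ N.places)
    (h : N.F p t ∨ N.F t p) : p ∈ S := by
  rcases E.cover p (mem_nodes_of_place hp) with hS | ⟨i, hi⟩
  · exact hS
  · exact absurd ht (E.notMem i t (E.bordered i p hi hp t h.symm))

theorem exists_twin (E : N.Exhaustion H tin S) {p w : α} (hp : p ∈ S) (hp' : p ∈ N.places)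
    (h : N.F p w) : ∃ t ∈ S, t ∈ N.transitions ∧ ∀ q, N.F q t ↔ N.F q w := by
  obtain ⟨-, t, ⟨ht, htp⟩, -⟩ := E.tnetS p hp hp'
  exact ⟨t, ht, transition_of_place_edge htp hp',
    fun q => ⟨fun hq => E.fc p hp' t htp q hq w h, fun hq => E.fc p hp' w h q hq t htp⟩⟩

theorem tin_pre (E : N.Exhaustion H tin S) (i : Fin (n + 1)) :
    ∃ p ∈ S, p ∈ N.places ∧ N.F p (tin i) := by
  obtain ⟨hi, -, p, hp, hpi, hF⟩ := E.wayIn i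
  rcases E.cover p (mem_nodes_of_place hp) with hS | ⟨j, hj⟩
  · exact ⟨p, hS, hp, hF⟩
  · have := E.eq_of_mem (E.bordered j p hj hp _ (Or.inr hF)) hi
    exact absurd (this ▸ hj) hpi

theorem not_inner_tin (E : N.Exhaustion H tin S) (i : Fin (n + 1)) : ¬ N.Inner S (tin i) := by
  intro h
  obtain ⟨p, hp, -, hF⟩ := E.tin_pre i
  exact h.2.2 p hF hp

theorem tin_notMem (E : N.Exhaustion H tin S) (i : Fin (n + 1)) : tin i ∉ S :=
  E.notMem i _ (E.wayIn i).1

theorem pre_mem_of_inner (E : N.Exhaustion H tin S) {i : Fin (n + 1)} {p t : α}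
    (h : N.Inner S t) (ht : t ∈ H i) (hF : N.F p t) : p ∈ H i := by
  have hp := place_of_edge_transition hF h.1
  rcases E.cover p (mem_nodes_of_place hp) with hS | ⟨j, hj⟩
  · exact absurd hS (h.2.2 p hF)
  · obtain rfl := E.eq_of_mem (E.bordered j p hj hp _ (Or.inr hF)) ht
    exact hj

theorem exists_mem_of_notMem (E : N.Exhaustion H tin S) {t : α} (ht : t ∈ N.transitions)
    (hS : t ∉ S) : ∃ i, t ∈ H i :=
  (E.cover t (mem_nodes_of_transition ht)).resolve_left hS

/-- Outside `S`, a transition that is not inner shares its pre-set with one of `S`. -/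
theorem exists_twin_of_not_inner (E : N.Exhaustion H tin S) {w : α} (hw : w ∈ N.transitions)
    (hi : ¬ N.Inner S w) : ∃ t ∈ S, t ∈ N.transitions ∧ ∀ q, N.F q t ↔ N.F q w := by
  by_cases hS : w ∈ S
  · exact ⟨w, hS, hw, fun _ => Iff.rfl⟩
  · simp only [Inner, not_and, not_forall, not_not] at hi
    obtain ⟨p, hF, hp⟩ := hi hw hS
    exact E.exists_twin hp (place_of_edge_transition hF hw) hF

theorem exists_place (E : N.Exhaustion H tin S) : ∃ p ∈ S, p ∈ N.places := by
  obtain ⟨p, hp, hp', -⟩ := E.tin_pre 0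
  exact ⟨p, hp, hp'⟩

theorem exists_pre (E : N.Exhaustion H tin S) {t : α} (ht : t ∈ S) (ht' : t ∈ N.transitions) :
    ∃ p ∈ S, p ∈ N.places ∧ N.F p t := by
  obtain ⟨p, hp, hp'⟩ := E.exists_place
  rcases Relation.ReflTransGen.cases_tail (E.sc p hp t ht) with h | ⟨q, -, hq, -, hF⟩
  · exact absurd ht' (Finset.disjoint_left.mp N.disj (h ▸ hp'))
  · exact ⟨q, hq, place_of_edge_transition hF ht', hF⟩

theorem flow_of_mem (E : N.Exhaustion H tin S) {x : α → ℚ} {i : Fin (n + 1)} {p a b : α}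
    (hp : p ∈ H i) (hp' : p ∈ N.places) (ha : N.F a p) (hb : N.F p b) :
    N.flow x p = x a - x b := by
  have hT := E.tnet i p hp hp'
  have hB := E.bordered i p hp hp'
  exact flow_eq_sub hp' ha hb
    (fun t ht _ => hT.1.unique ⟨hB t (Or.inl ht), ht⟩ ⟨hB a (Or.inl ha), ha⟩)
    (fun t ht _ => hT.2.unique ⟨hB t (Or.inr ht), ht⟩ ⟨hB b (Or.inr hb), hb⟩)

theorem flow_of_mem_core (E : N.Exhaustion H tin S) {x : α → ℚ} {p a b : α}
    (hx : ∀ t ∈ N.transitions, t ∉ S → x t = 0) (hp : p ∈ S) (hp' : p ∈ N.places)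
    (ha : a ∈ S) (hb : b ∈ S) (hap : N.F a p) (hpb : N.F p b) :
    N.flow x p = x a - x b := by
  have hT := E.tnetS p hp hp'
  have hxS : ∀ t ∈ N.transitions, x t ≠ 0 → t ∈ S := fun t ht hne => by
    by_contra h
    exact hne (hx t ht h)
  exact flow_eq_sub hp' hap hpb
    (fun t ht hne => hT.1.unique ⟨hxS t (transition_of_edge_place ht hp') hne, ht⟩ ⟨ha, hap⟩)
    (fun t ht hne => hT.2.unique ⟨hxS t (transition_of_place_edge ht hp') hne, ht⟩ ⟨hb, hpb⟩)

/-- A T-invariant is constant on the transitions of each `H i`. -/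
theorem const_of_flow_eq_zero (E : N.Exhaustion H tin S) {x : α → ℚ}
    (hx : ∀ p ∈ N.places, N.flow x p = 0) {i : Fin (n + 1)} {t u : α} (ht : t ∈ H i)
    (ht' : t ∈ N.transitions) (hu : u ∈ H i) (hu' : u ∈ N.transitions) : x u = x t :=
  (E.wc i).const (E.tnet i)
    (fun p hp hp' a _ b _ ha hb => by
      have := E.flow_of_mem (x := x) hp hp' ha hb
      rw [hx p hp'] at this
      linarith) ht ht' hu hu'

/-! ### Firing inside `S` -/

theorem restrict_enabled (E : N.Exhaustion H tin S) {m : α → ℕ} {t : α} :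
    (N.restrict S).Enabled m t ↔ N.Enabled m t ∧ t ∈ S := by
  constructor
  · rintro ⟨ht, h⟩
    have ht := Finset.mem_inter.mp ht
    exact ⟨⟨ht.1, fun p hp => h p ⟨E.place_mem ht.2 (place_of_edge_transition hp ht.1)
      (Or.inl hp), ht.2, hp⟩⟩, ht.2⟩
  · rintro ⟨⟨ht, h⟩, htS⟩
    exact ⟨Finset.mem_inter.mpr ⟨ht, htS⟩, fun p hp => h p hp.2.2⟩

theorem restrict_fire (E : N.Exhaustion H tin S) {t : α} (ht : t ∈ S)
    (ht' : t ∈ N.transitions) (m : α → ℕ) : (N.restrict S).fire t m = N.fire t m := by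
  funext p
  have h1 : (N.restrict S).F p t ↔ N.F p t :=
    ⟨fun h => h.2.2, fun h => ⟨E.place_mem ht (place_of_edge_transition h ht') (Or.inl h), ht, h⟩⟩
  have h2 : (N.restrict S).F t p ↔ N.F t p :=
    ⟨fun h => h.2.2, fun h => ⟨ht, E.place_mem ht (place_of_transition_edge h ht') (Or.inr h), h⟩⟩
  simp only [fire, h1, h2]

theorem restrict_fireSeq (E : N.Exhaustion H tin S) {m m' : α → ℕ} {σ : List α} :
    (N.restrict S).FireSeq m σ m' ↔ N.FireSeq m σ m' ∧ ∀ t ∈ σ, t ∈ S := by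
  constructor
  · intro h
    induction h with
    | nil => exact ⟨FireSeq.nil _, by simp⟩
    | cons he _ ih =>
      obtain ⟨he, hS⟩ := E.restrict_enabled.mp he
      rw [E.restrict_fire hS he.1] at ih
      exact ⟨FireSeq.cons he ih.1, List.forall_mem_cons.mpr ⟨hS, ih.2⟩⟩
  · rintro ⟨h, hS⟩
    induction h with
    | nil => exact FireSeq.nil _
    | cons he _ ih =>
      have hS := List.forall_mem_cons.mp hS
      refine FireSeq.cons (E.restrict_enabled.mpr ⟨he, hS.1⟩) ?_
      rw [E.restrict_fire hS.1 he.1]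
      exact ih hS.2

theorem quiet_of_fireSeq (E : N.Exhaustion H tin S) {m m' : α → ℕ} {σ : List α}
    (h : N.FireSeq m σ m') (hS : ∀ t ∈ σ, t ∈ S) (hq : N.Quiet S m) : N.Quiet S m' := by
  induction h with
  | nil => exact hq
  | @cons μ ν t σ he _ ih =>
    have hS := List.forall_mem_cons.mp hS
    refine ih hS.2 fun u hu hen => hq u hu ⟨hu.1, fun p hp => ?_⟩
    have hpS := hu.2.2 p hp
    have hpp := place_of_edge_transition hp hu.1
    have h1 : ¬ N.F p t := fun h => hpS (E.place_mem hS.1 hpp (Or.inl h))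
    have h2 : ¬ N.F t p := fun h => hpS (E.place_mem hS.1 hpp (Or.inr h))
    simpa [fire, h1, h2] using hen.2 p hp

/-- The final T-net is live at every quiet marking. -/
theorem live_restrict (E : N.Exhaustion H tin S) {m : α → ℕ} {K : ℕ} (hl : N.Live m)
    (hb : N.BoundedBy K m) (hq : N.Quiet S m) : (N.restrict S).Live m := by
  intro t ht m₁ hm₁
  have htS := (Finset.mem_inter.mp ht).2
  have ht' := (Finset.mem_inter.mp ht).1
  by_contra! hcon
  obtain ⟨a, b, ⟨ha1, ha2⟩, ⟨σ, hσ, hne⟩, hab⟩ := exists_rel_markingEq (N := N)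
    (Inv := fun a => (N.restrict S).Reach m a ∧
      ∀ ν, (N.restrict S).Reach a ν → ¬ (N.restrict S).Enabled ν t)
    (R := fun a b => ∃ σ, (N.restrict S).FireSeq a σ b ∧ σ ≠ [])
    (fun a b c ⟨σ, h1, h2⟩ ⟨τ, h3, _⟩ => ⟨σ ++ τ, h1.append h3, by simp [h2]⟩)
    (K := K)
    (fun a ⟨⟨σ, hσ⟩, _⟩ p hp => hb a ⟨σ, (E.restrict_fireSeq.mp hσ).1⟩ p hp)
    (fun a ⟨ha1, ha2⟩ => by
      obtain ⟨σ, hσ⟩ := ha1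
      obtain ⟨hσN, hσS⟩ := E.restrict_fireSeq.mp hσ
      have hqa := E.quiet_of_fireSeq hσN hσS hq
      obtain ⟨u, hu⟩ := (hl.of_reach hσN.reach).exists_enabled ht'
      obtain ⟨v, hv, hv', hvu⟩ := E.exists_twin_of_not_inner hu.1 (fun h => hqa u h hu)
      have hvr : (N.restrict S).Enabled a v :=
        E.restrict_enabled.mpr ⟨⟨hv', fun p hp => hu.2 p ((hvu p).mp hp)⟩, hv⟩
      have hs := FireSeq.single hvr
      exact ⟨_, ⟨⟨_, hσ.append hs⟩, fun ν hν => ha2 ν (hs.reach.trans hν)⟩, _, hs, by simp⟩)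
    ⟨hm₁, hcon⟩
  obtain ⟨hσN, hσS⟩ := E.restrict_fireSeq.mp hσ
  have hflow : ∀ p ∈ N.places, N.flow (fun t => (σ.count t : ℚ)) p = 0 := by
    intro p hp
    have := hσN.state_equation p
    rw [hab p hp] at this
    linarith
  have hconst : ∀ u ∈ S, u ∈ N.transitions → (σ.count u : ℚ) = σ.count t := fun u hu hu' =>
    E.sc.weaklyConnectedOn.const E.tnetS (f := fun t => (σ.count t : ℚ))
      (fun p hp hp' a ha b hb hap hpb => by
        have := E.flow_of_mem_core (x := fun t => (σ.count t : ℚ))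
          (fun v _ hv => by simp [List.count_eq_zero_of_not_mem fun h => hv (hσS v h)])
          hp hp' ha hb hap hpb
        rw [hflow p hp'] at this
        linarith) htS ht' hu hu'
  obtain ⟨u, hu⟩ := List.exists_mem_of_ne_nil σ hne
  have h1 := hconst u (hσS u hu) (hσN.mem_transitions u hu)
  have htσ : t ∈ σ := by
    rw [← List.count_pos_iff]
    have h2 := List.count_pos_iff.mpr hu
    have : σ.count u = σ.count t := by exact_mod_cast h1
    omega
  obtain ⟨τ, ρ, hτ, hen, -⟩ := hσ.exists_enabled_of_mem htσ
  exact ha2 ρ hτ.reach hen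

/-! ### Shutting down and pumping -/

/-- From every marking of a bounded system a quiet marking can be reached by firing
inner transitions only. -/
theorem exists_quiet (E : N.Exhaustion H tin S) {m : α → ℕ} {K : ℕ}
    (hb : N.BoundedBy K m) :
    ∃ b σ, N.FireSeq m σ b ∧ (∀ t ∈ σ, N.Inner S t) ∧ N.Quiet S b := by
  by_contra! hcon
  obtain ⟨a, b, -, ⟨σ, hσ, hne, hin⟩, hab⟩ := exists_rel_markingEq (N := N)
    (Inv := fun a => N.Reach m a ∧
      ∀ b σ, N.FireSeq a σ b → (∀ t ∈ σ, N.Inner S t) → ¬ N.Quiet S b)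
    (R := fun a b => ∃ σ, N.FireSeq a σ b ∧ σ ≠ [] ∧ ∀ t ∈ σ, N.Inner S t)
    (fun a b c ⟨σ, h1, h2, h3⟩ ⟨τ, h4, _, h5⟩ => ⟨σ ++ τ, h1.append h4, by simp [h2],
      fun t ht => (List.mem_append.mp ht).elim (h3 t) (h5 t)⟩)
    (K := K)
    (fun a ha p hp => hb a ha.1 p hp)
    (fun a ⟨ha1, ha2⟩ => by
      have hnq := ha2 a [] (FireSeq.nil _) (by simp)
      simp only [Quiet, not_forall, not_not] at hnq
      obtain ⟨t, hti, hte⟩ := hnq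
      exact ⟨_, ⟨ha1.trans (FireSeq.single hte).reach, fun b σ hσ hin =>
        ha2 b (t :: σ) (FireSeq.cons hte hσ) (List.forall_mem_cons.mpr ⟨hti, hin⟩)⟩,
        [t], FireSeq.single hte, by simp, by simpa using hti⟩)
    ⟨Reach.refl m, hcon⟩
  have hflow : ∀ p ∈ N.places, N.flow (fun t => (σ.count t : ℚ)) p = 0 := by
    intro p hp
    have := hσ.state_equation p
    rw [hab p hp] at this
    linarith
  obtain ⟨u, hu⟩ := List.exists_mem_of_ne_nil σ hne
  have hui := hin u hu
  obtain ⟨i, hi⟩ := E.exists_mem_of_notMem hui.1 hui.2.1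
  have h1 := E.const_of_flow_eq_zero hflow (E.wayIn i).1 (E.wayIn i).2.1 hi hui.1
  have h2 : σ.count (tin i) = 0 :=
    List.count_eq_zero_of_not_mem fun h => E.not_inner_tin i (hin _ h)
  have h3 := List.count_pos_iff.mpr hu
  have h4 : σ.count u = σ.count (tin i) := by exact_mod_cast h1
  omega

/-- There is a T-invariant that is positive on `tin i` and vanishes on all other
transitions that are neither inner nor in `S`. -/
theorem exists_invariant (E : N.Exhaustion H tin S) {m : α → ℕ} {K : ℕ} (hl : N.Live m)
    (hb : N.BoundedBy K m) (hq : N.Quiet S m) (i : Fin (n + 1)) :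
    ∃ y : α → ℚ, (∀ p ∈ N.places, N.flow y p = 0) ∧ 0 < y (tin i) ∧
      ∀ w ∈ N.transitions, w ∉ S → ¬ N.Inner S w → w ≠ tin i → y w = 0 := by
  obtain ⟨a, b, -, ⟨σ, hσ, hmem, hin⟩, hab⟩ := exists_rel_markingEq (N := N)
    (Inv := fun a => N.Reach m a ∧ N.Quiet S a)
    (R := fun a b => ∃ σ, N.FireSeq a σ b ∧ tin i ∈ σ ∧
      ∀ t ∈ σ, t ∈ S ∨ N.Inner S t ∨ t = tin i)
    (fun a b c ⟨σ, h1, h2, h3⟩ ⟨τ, h4, _, h5⟩ => ⟨σ ++ τ, h1.append h4,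
      List.mem_append_left _ h2, fun t ht => (List.mem_append.mp ht).elim (h3 t) (h5 t)⟩)
    (K := K)
    (fun a ha p hp => hb a ha.1 p hp)
    (fun a ⟨ha1, ha2⟩ => by
      obtain ⟨v, hv, hv', hvu⟩ :=
        E.exists_twin_of_not_inner (E.wayIn i).2.1 (E.not_inner_tin i)
      obtain ⟨c, ⟨σ, hσ⟩, hc⟩ := E.live_restrict (hl.of_reach ha1) (hb.of_reach ha1) ha2 v
        (Finset.mem_inter.mpr ⟨hv', hv⟩) a (Reach.refl a)
      obtain ⟨hσ, hσS⟩ := E.restrict_fireSeq.mp hσ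
      have hct : N.Enabled c (tin i) :=
        ⟨(E.wayIn i).2.1, fun p hp => (E.restrict_enabled.mp hc).1.2 p ((hvu p).mpr hp)⟩
      have hd := hσ.append (FireSeq.single hct)
      obtain ⟨b, τ, hτ, hτi, hbq⟩ := E.exists_quiet (hb.of_reach (ha1.trans hd.reach))
      refine ⟨b, ⟨ha1.trans (hd.append hτ).reach, hbq⟩, _, hd.append hτ, by simp, ?_⟩
      intro t ht
      simp only [List.mem_append, List.mem_singleton] at ht
      rcases ht with (ht | ht) | ht
      · exact Or.inl (hσS t ht)
      · exact Or.inr (Or.inr ht)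
      · exact Or.inr (Or.inl (hτi t ht)))
    ⟨Reach.refl m, hq⟩
  refine ⟨fun t => (σ.count t : ℚ), ?_, ?_, ?_⟩
  · intro p hp
    have := hσ.state_equation p
    rw [hab p hp] at this
    linarith
  · exact Nat.cast_pos.mpr (List.count_pos_iff.mpr hmem)
  · intro w _ hwS hwi hwt
    have : w ∉ σ := fun h => by
      rcases hin w h with h | h | h
      · exact hwS h
      · exact hwi h
      · exact hwt h
    simp [List.count_eq_zero_of_not_mem this]

/-- In the presence of a live, bounded and quiet marking, way-in transitions are unique. -/
theorem inner_of_ne_tin (E : N.Exhaustion H tin S) {m : α → ℕ} {K : ℕ} (hl : N.Live m)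
    (hb : N.BoundedBy K m) (hq : N.Quiet S m) {i : Fin (n + 1)} {w : α} (hw : w ∈ H i)
    (hw' : w ∈ N.transitions) (hne : w ≠ tin i) : N.Inner S w := by
  by_contra hcon
  obtain ⟨y, hy, hpos, h0⟩ := E.exists_invariant hl hb hq i
  have h1 := E.const_of_flow_eq_zero hy (E.wayIn i).1 (E.wayIn i).2.1 hw hw'
  rw [h0 w hw' (E.notMem i w hw) hcon hne] at h1
  linarith

/-- Between quiet markings all transitions of `H i` fire equally often. -/
theorem count_eq_count_tin (E : N.Exhaustion H tin S) {m m' : α → ℕ} {σ : List α} {K : ℕ}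
    (hl : N.Live m) (hb : N.BoundedBy K m) (hq : N.Quiet S m) (hq' : N.Quiet S m')
    (h : N.FireSeq m σ m') {i : Fin (n + 1)} {t : α} (ht : t ∈ H i)
    (ht' : t ∈ N.transitions) : σ.count t = σ.count (tin i) := by
  have hpre : ∀ {c : α → ℕ} {u : α}, N.Quiet S c → u ∈ H i → u ∈ N.transitions →
      u ≠ tin i → ∃ p ∈ H i, p ∈ N.places ∧ N.F p u ∧ c p = 0 := by
    intro c u hc hu hu' hne
    have hui := E.inner_of_ne_tin hl hb hq hu hu' hne
    have hnot := hc u hui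
    simp only [Enabled, hu', true_and, not_forall] at hnot
    obtain ⟨p, hp, hp0⟩ := hnot
    exact ⟨p, E.pre_mem_of_inner hui hu hp, place_of_edge_transition hp hu', hp, by omega⟩
  have heq : ∀ {p a b : α}, p ∈ H i → p ∈ N.places → N.F a p → N.F p b →
      m' p + σ.count b = m p + σ.count a := by
    intro p a b hp hp' ha hb
    have h1 := h.state_equation p
    rw [E.flow_of_mem hp hp' ha hb] at h1
    have h2 : (m' p : ℚ) + σ.count b = m p + σ.count a := by linarith
    exact_mod_cast h2
  apply le_antisymm
  · by_contra! hlt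
    obtain ⟨u, ⟨hu, hu', hlt⟩, hfed⟩ := hl.exists_forall_marked_or_fed
      (V := {u | u ∈ H i ∧ u ∈ N.transitions ∧ σ.count (tin i) < σ.count u})
      (fun u hu => hu.2.1) ⟨ht, ht', hlt⟩
    obtain ⟨p, hp, hp', hF, h0⟩ := hpre hq hu hu' (by rintro rfl; omega)
    obtain ⟨a, ha, haV⟩ := hfed p hF h0
    have := heq hp hp' ha hF
    exact haV ⟨E.bordered i p hp hp' a (Or.inl ha), transition_of_edge_place ha hp', by omega⟩
  · by_contra! hlt
    obtain ⟨u, ⟨hu, hu', hlt⟩, hfed⟩ := (hl.of_reach h.reach).exists_forall_marked_or_fed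
      (V := {u | u ∈ H i ∧ u ∈ N.transitions ∧ σ.count u < σ.count (tin i)})
      (fun u hu => hu.2.1) ⟨ht, ht', hlt⟩
    obtain ⟨p, hp, hp', hF, h0⟩ := hpre hq' hu hu' (by rintro rfl; omega)
    obtain ⟨a, ha, haV⟩ := hfed p hF h0
    have := heq hp hp' ha hF
    exact haV ⟨E.bordered i p hp hp' a (Or.inl ha), transition_of_edge_place ha hp', by omega⟩

/-- Between quiet markings the marking of `S` changes as if only transitions of `S` had
fired, possibly a negative number of times. -/
theorem exists_core_vector (E : N.Exhaustion H tin S) {m m' : α → ℕ} {K : ℕ}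
    (hl : N.Live m) (hb : N.BoundedBy K m) (hq : N.Quiet S m) (hq' : N.Quiet S m')
    (h : N.Reach m m') {r : α} (hr : r ∈ S) (hr' : r ∈ N.transitions) :
    ∃ w : α → ℤ, w r = 0 ∧ ∀ p ∈ S, p ∈ N.places → ∀ a ∈ S, ∀ b ∈ S, N.F a p → N.F p b →
      (m' p : ℤ) = m p + w a - w b := by
  obtain ⟨σ, hσ⟩ := h
  choose y hy hpos h0 using fun i => E.exists_invariant hl hb hq i
  let z : α → ℚ := fun t => (σ.count t : ℚ) -
    ∑ i, ((σ.count (tin i) : ℚ) / y i (tin i)) * y i t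
  have hz : ∀ p ∈ N.places, (m' p : ℚ) = m p + N.flow z p := by
    intro p hp
    rw [hσ.state_equation p]
    simp only [z, flow_sub, flow_sum_mul, hy _ p hp, mul_zero, Finset.sum_const_zero, sub_zero]
  have hz0 : ∀ t ∈ N.transitions, t ∉ S → z t = 0 := by
    intro t ht htS
    obtain ⟨j, hj⟩ := E.exists_mem_of_notMem ht htS
    have hyt : ∀ i, y i t = y i (tin j) := fun i =>
      E.const_of_flow_eq_zero (hy i) (E.wayIn j).1 (E.wayIn j).2.1 hj ht
    simp only [z, hyt, E.count_eq_count_tin hl hb hq hq' hσ hj ht]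
    rw [Finset.sum_eq_single j, div_mul_cancel₀ _ (hpos j).ne', sub_self]
    · intro i _ hij
      rw [h0 i (tin j) (E.wayIn j).2.1 (E.tin_notMem j) (E.not_inner_tin j), mul_zero]
      intro he
      exact hij (E.eq_of_mem (he ▸ (E.wayIn i).1) (E.wayIn j).1)
    · simp
  have hdiff : ∀ p ∈ S, p ∈ N.places → ∀ a ∈ S, ∀ b ∈ S, N.F a p → N.F p b →
      (m' p : ℚ) = m p + z a - z b := by
    intro p hp hp' a ha b hb hap hpb
    rw [hz p hp', E.flow_of_mem_core hz0 hp hp' ha hb hap hpb]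
    ring
  have hint : ∀ t, ∃ k : ℤ, t ∈ S → t ∈ N.transitions → z t - z r = k := by
    intro t
    by_cases ht : t ∈ S ∧ t ∈ N.transitions
    · have := E.sc.weaklyConnectedOn.const E.tnetS (f := fun t => Int.fract (z t))
        (fun p hp hp' a ha b hb hap hpb => Int.fract_eq_fract.mpr
          ⟨(m' p : ℤ) - m p, by
            have := hdiff p hp hp' a ha b hb hap hpb
            push_cast
            linarith⟩) hr hr' ht.1 ht.2
      obtain ⟨k, hk⟩ := Int.fract_eq_fract.mp this
      exact ⟨k, fun _ _ => hk⟩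
    · exact ⟨0, fun h1 h2 => absurd ⟨h1, h2⟩ ht⟩
  choose w hw using hint
  refine ⟨w, ?_, ?_⟩
  · have := hw r hr hr'
    rw [sub_self] at this
    exact_mod_cast this.symm
  · intro p hp hp' a ha b hb hap hpb
    have h1 := hdiff p hp hp' a ha b hb hap hpb
    have h2 := hw a ha (transition_of_edge_place hap hp')
    have h3 := hw b hb (transition_of_place_edge hpb hp')
    have h4 : (m' p : ℚ) = m p + w a - w b := by linarith
    exact_mod_cast h4

/-! ### The final T-net -/

theorem isTNet_restrict (E : N.Exhaustion H tin S) : (N.restrict S).IsTNet := by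
  intro p hp
  obtain ⟨hp', hp⟩ := Finset.mem_inter.mp hp
  obtain ⟨⟨a, ha, hua⟩, ⟨b, hb, hub⟩⟩ := E.tnetS p hp hp'
  exact ⟨⟨a, ⟨ha.1, hp, ha.2⟩, fun t ht => hua t ⟨ht.1, ht.2.2⟩⟩,
    ⟨b, ⟨hp, hb.1, hb.2⟩, fun t ht => hub t ⟨ht.2.1, ht.2.2⟩⟩⟩

theorem not_edge_of_ne (E : N.Exhaustion H tin S) {p t r : α} (hp : p ∈ S)
    (hp' : p ∈ N.places) (ht : t ∈ S) (hr : r ∈ S) (h : N.F p t) (hne : t ≠ r) : ¬ N.F p r :=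
  fun hpr => hne ((E.tnetS p hp hp').2.unique ⟨ht, h⟩ ⟨hr, hpr⟩)

/-- A firing vector leading to the marking of `•r` without firing `r` fires every
transition of `S` at most once, and never negatively. -/
theorem core_vector_bounds (E : N.Exhaustion H tin S) {m c : α → ℕ} {w : α → ℤ} {r : α}
    (hr : r ∈ S) (hr' : r ∈ N.transitions) (hw : w r = 0)
    (hc : ∀ p, c p = if N.F p r then 1 else 0)
    (h : ∀ p ∈ S, p ∈ N.places → ∀ a ∈ S, ∀ b ∈ S, N.F a p → N.F p b →
      (c p : ℤ) = m p + w a - w b)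
    {t : α} (ht : t ∈ S) (ht' : t ∈ N.transitions) : 0 ≤ w t ∧ w t ≤ 1 := by
  constructor
  · by_contra! hlt
    have := E.sc.of_pred_closed (V := fun t => w t < 0)
      (fun u hu hwu p hp hpu t ht ht' htp => by
        have hp' := place_of_transition_edge htp ht'
        have hne : u ≠ r := by rintro rfl; omega
        have e := h p hp hp' t ht u hu htp hpu
        rw [hc p, if_neg (E.not_edge_of_ne hp hp' hu hr hpu hne)] at e
        omega) ht ht' hr hr' hlt
    omega
  · by_contra! hlt
    have := E.sc.of_succ_closed (V := fun t => 1 < w t)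
      (fun t ht ht' hwt p hp htp u hu hpu => by
        have hp' := place_of_transition_edge htp ht'
        have e := h p hp hp' t ht u hu htp hpu
        by_cases hur : u = r
        · subst hur
          rw [hc p, if_pos hpu] at e
          omega
        · rw [hc p, if_neg (E.not_edge_of_ne hp hp' hu hr hpu hur)] at e
          omega) ht ht' hr hr' hlt
    omega

theorem reach_restrict_of_vector (E : N.Exhaustion H tin S) {m m' : α → ℕ} {y : α → ℤ}
    (hl : (N.restrict S).Live m) (hy : ∀ t ∈ S, t ∈ N.transitions → 0 ≤ y t)
    (h : ∀ p ∈ S, p ∈ N.places → ∀ a ∈ S, ∀ b ∈ S, N.F a p → N.F p b →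
      (m' p : ℤ) = m p + y a - y b) :
    ∃ ν, (N.restrict S).Reach m ν ∧ (N.restrict S).MarkingEq ν m' := by
  refine E.isTNet_restrict.reach_of_state_equation (y := fun t => (y t).toNat) hl ?_
  intro p hp a b ha hb
  obtain ⟨hp', hp⟩ := Finset.mem_inter.mp hp
  have e := h p hp hp' a ha.1 b hb.2.1 ha.2.2 hb.2.2
  have h1 := hy a ha.1 (transition_of_edge_place ha.2.2 hp')
  have h2 := hy b hb.2.1 (transition_of_place_edge hb.2.2 hp')
  simp only [Int.toNat_of_nonneg h1, Int.toNat_of_nonneg h2]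
  exact e

/-- One half of the comparison of the firing vectors that lead two shut down markings to the
marking of `•r`. -/
theorem core_vector_le (E : N.Exhaustion H tin S) {μ₁ μ₂ m₁ m₂ c : α → ℕ} {w₁ w₂ : α → ℤ}
    {r : α} (hr : r ∈ S) (hr' : r ∈ N.transitions) (hw₁ : w₁ r = 0) (hw₂ : w₂ r = 0)
    (hc : ∀ p, c p = if N.F p r then 1 else 0)
    (h₁ : ∀ p ∈ S, p ∈ N.places → ∀ a ∈ S, ∀ b ∈ S, N.F a p → N.F p b →
      (c p : ℤ) = m₁ p + w₁ a - w₁ b)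
    (h₂ : ∀ p ∈ S, p ∈ N.places → ∀ a ∈ S, ∀ b ∈ S, N.F a p → N.F p b →
      (c p : ℤ) = m₂ p + w₂ a - w₂ b)
    (hl : (N.restrict S).Live m₁) (hen : N.en μ₁ = N.en μ₂)
    (hd : ∀ p, (m₁ p : ℤ) - μ₁ p = m₂ p - μ₂ p) (hge : ∀ p ∈ S, μ₂ p ≤ m₂ p)
    {t : α} (ht : t ∈ S) (ht' : t ∈ N.transitions) : w₁ t ≤ w₂ t := by
  by_contra! hlt
  obtain ⟨u, ⟨hu, hu', hlt⟩, hfed⟩ := hl.exists_forall_marked_or_fed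
    (V := {u | u ∈ S ∧ u ∈ N.transitions ∧ w₂ u < w₁ u})
    (fun u hu => Finset.mem_inter.mpr ⟨hu.2.1, hu.1⟩) ⟨ht, ht', hlt⟩
  have hne : u ≠ r := by rintro rfl; omega
  have hpre : ∀ {p}, N.F p u → p ∈ S ∧ p ∈ N.places ∧ c p = 0 := fun {p} hp => by
    have hp' := place_of_edge_transition hp hu'
    have hpS := E.place_mem hu hp' (Or.inl hp)
    exact ⟨hpS, hp', by rw [hc p, if_neg (E.not_edge_of_ne hpS hp' hu hr hp hne)]⟩
  have hmarked : ∀ p, N.F p u → 1 ≤ m₁ p := by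
    intro p hp
    by_contra h0
    obtain ⟨hpS, hp', hcp⟩ := hpre hp
    obtain ⟨a, ha, haV⟩ := hfed p ⟨hpS, hu, hp⟩ (by omega)
    have e1 := h₁ p hpS hp' a ha.1 u hu ha.2.2 hp
    have e2 := h₂ p hpS hp' a ha.1 u hu ha.2.2 hp
    exact haV ⟨ha.1, transition_of_edge_place ha.2.2 hp', by omega⟩
  obtain ⟨p, hp, hm⟩ : ∃ p, N.F p u ∧ 1 ≤ m₂ p := by
    by_cases he : N.Enabled μ₂ u
    · obtain ⟨p, hpS, -, hp⟩ := E.exists_pre hu hu'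
      exact ⟨p, hp, (he.2 p hp).trans (hge p hpS)⟩
    · have he₁ : ¬ N.Enabled μ₁ u := fun h => he ((Set.ext_iff.mp hen u).mp h)
      simp only [Enabled, hu', true_and, not_forall] at he₁
      obtain ⟨p, hp, h0⟩ := he₁
      have h3 := hmarked p hp
      have h4 := hd p
      exact ⟨p, hp, by omega⟩
  obtain ⟨hpS, hp', hcp⟩ := hpre hp
  obtain ⟨a, ⟨ha, hap⟩, -⟩ := (E.tnetS p hpS hp').1
  have e2 := h₂ p hpS hp' a ha u hu hap hp
  have b1 := (E.core_vector_bounds hr hr' hw₁ hc h₁ hu hu').2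
  have b2 := (E.core_vector_bounds hr hr' hw₂ hc h₂ ha (transition_of_edge_place hap hp')).1
  omega

/-! ### Global shutdown -/

theorem count_flatten_ofFn (E : N.Exhaustion H tin S) {σs : Fin (n + 1) → List α}
    (hσ : ∀ i, ∀ t ∈ σs i, t ∈ H i) {i : Fin (n + 1)} {t : α} (ht : t ∈ H i) :
    (List.ofFn σs).flatten.count t = (σs i).count t := by
  rw [List.count_flatten, List.map_ofFn, List.sum_ofFn, Finset.sum_eq_single i]
  · rfl
  · intro j _ hj
    exact List.count_eq_zero_of_not_mem fun h => hj (E.eq_of_mem (hσ j t h) ht)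
  · simp

theorem quiet_of_shutdown (E : N.Exhaustion H tin S) {σs : Fin (n + 1) → List α}
    {μ m : α → ℕ} (hsd : ∀ i, ∃ ν, N.IsShutdownSeq (H i) (tin i) μ (σs i) ν)
    (h : N.FireSeq μ (List.ofFn σs).flatten m) : N.Quiet S m := by
  intro t ht hen
  obtain ⟨i, hi⟩ := E.exists_mem_of_notMem ht.1 ht.2.1
  have hmem : ∀ i, ∀ t ∈ σs i, t ∈ H i := fun i t ht => by
    obtain ⟨ν, -, hν, -⟩ := hsd i
    exact (hν t ht).1
  obtain ⟨ν, hν, -, hdead⟩ := hsd i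
  refine hdead t hi ht.1 (fun he => E.not_inner_tin i (he ▸ ht)) ⟨ht.1, fun p hp => ?_⟩
  have hp' := place_of_edge_transition hp ht.1
  have hpi := E.pre_mem_of_inner ht hi hp
  obtain ⟨a, ⟨ha, hap⟩, -⟩ := (E.tnet i p hpi hp').1
  have e1 := h.state_equation p
  have e2 := hν.state_equation p
  rw [E.flow_of_mem hpi hp' hap hp, E.count_flatten_ofFn hmem ha,
    E.count_flatten_ofFn hmem hi] at e1
  rw [E.flow_of_mem hpi hp' hap hp] at e2
  have e3 : m p = ν p := by exact_mod_cast e1.trans e2.symm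
  exact e3 ▸ hen.2 p hp

/-- A cluster adapted to all `H i` is the cluster of a transition of `S`. -/
theorem exists_cluster_transition (E : N.Exhaustion H tin S) {cl : Set α} (hcl : N.IsCluster cl)
    (had : ∀ i, ¬ cl ⊆ (H i : Set α)) :
    ∃ r ∈ S, r ∈ N.transitions ∧ cl = N.freeChoiceCluster r := by
  obtain ⟨x, hx, rfl⟩ := hcl
  have hH : ∀ i, x ∈ H i → ¬ (x ∈ N.places ∨ N.Inner S x) := by
    intro i hi hxi
    refine had i fun y hy => (hy {z | z ∈ H i ∧ (z ∈ N.places ∨ N.Inner S z)}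
      ⟨⟨hi, hxi⟩, ?_, ?_⟩).1
    · rintro p ⟨hp, -⟩ hp' t ht
      have htH := E.bordered i p hp hp' t (Or.inr ht)
      refine ⟨htH, Or.inr ⟨transition_of_place_edge ht hp', E.notMem i t htH, ?_⟩⟩
      intro q hq hqS
      obtain ⟨v, hv, -, hvt⟩ := E.exists_twin hqS
        (place_of_edge_transition hq (transition_of_place_edge ht hp')) hq
      exact E.notMem i p hp (E.place_mem hv hp' (Or.inl ((hvt p).mpr ht)))
    · rintro t ⟨ht, hti⟩ ht' p hp
      have hti := hti.resolve_left fun h => Finset.disjoint_left.mp N.disj h ht'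
      exact ⟨E.pre_mem_of_inner hti ht hp, Or.inl (place_of_edge_transition hp ht')⟩
  obtain ⟨r, hr, hr', hxr⟩ : ∃ r ∈ S, r ∈ N.transitions ∧ x ∈ N.freeChoiceCluster r := by
    rcases Finset.mem_union.mp hx with hxp | hxt
    · have hxS := (E.cover x hx).resolve_right fun ⟨i, hi⟩ => hH i hi (Or.inl hxp)
      obtain ⟨-, r, ⟨hr, hF⟩, -⟩ := E.tnetS x hxS hxp
      exact ⟨r, hr, transition_of_place_edge hF hxp, Or.inl hF⟩
    · have hni : ¬ N.Inner S x := fun h => by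
        obtain ⟨i, hi⟩ := E.exists_mem_of_notMem hxt h.2.1
        exact hH i hi (Or.inr h)
      obtain ⟨r, hr, hr', hrx⟩ := E.exists_twin_of_not_inner hxt hni
      exact ⟨r, hr, hr', Or.inr ⟨hxt, fun q => (hrx q).symm⟩⟩
  obtain ⟨p, -, -, hp⟩ := E.exists_pre hr hr'
  exact ⟨r, hr, hr', E.fc.clusterOf_eq hp hr' hxr⟩

theorem restrict_freeChoice (E : N.Exhaustion H tin S) : (N.restrict S).FreeChoice := by
  rintro p hp t ⟨_, _, ht⟩ p' ⟨hp'S, _, hp'⟩ t' ⟨_, ht'S, ht'⟩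
  exact ⟨hp'S, ht'S, E.fc p (Finset.mem_inter.mp hp).1 t ht p' hp' t' ht'⟩

theorem isCluster_restrict (E : N.Exhaustion H tin S) {r : α} (hr : r ∈ S)
    (hr' : r ∈ N.transitions) :
    (N.restrict S).IsCluster (N.freeChoiceCluster r ∩ (S : Set α)) := by
  have hrM : r ∈ (N.restrict S).transitions := Finset.mem_inter.mpr ⟨hr', hr⟩
  refine ⟨r, mem_nodes_of_transition hrM, ?_⟩
  obtain ⟨p, hpS, -, hp⟩ := E.exists_pre hr hr'
  rw [E.restrict_freeChoice.clusterOf_eq (p := p) ⟨hpS, hr, hp⟩ hrM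
    (Or.inr ⟨hrM, fun _ => Iff.rfl⟩)]
  have hF : ∀ {q t}, t ∈ S → t ∈ N.transitions → ((N.restrict S).F q t ↔ N.F q t) :=
    fun {q t} ht ht' => ⟨fun h => h.2.2,
      fun h => ⟨E.place_mem ht (place_of_edge_transition h ht') (Or.inl h), ht, h⟩⟩
  ext x
  constructor
  · rintro ⟨hx | hx, hxS⟩
    · exact Or.inl ⟨hxS, hr, hx⟩
    · exact Or.inr ⟨Finset.mem_inter.mpr ⟨hx.1, hxS⟩, fun q => by
        rw [hF hxS hx.1, hF hr hr']
        exact hx.2 q⟩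
  · rintro (hx | hx)
    · exact ⟨Or.inl hx.2.2, hx.1⟩
    · obtain ⟨hx1, hx2⟩ := Finset.mem_inter.mp hx.1
      refine ⟨Or.inr ⟨hx1, fun q => ?_⟩, hx2⟩
      rw [← hF hx2 hx1, ← hF hr hr']
      exact hx.2 q

theorem restrict_clusterMarking (E : N.Exhaustion H tin S) {r : α} (hr : r ∈ S) :
    (N.restrict S).clusterMarking (N.freeChoiceCluster r ∩ (S : Set α)) =
      N.clusterMarking (N.freeChoiceCluster r) := by
  funext p
  have : (p ∈ N.freeChoiceCluster r ∩ (S : Set α) ∧ p ∈ (N.restrict S).places) ↔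
      (p ∈ N.freeChoiceCluster r ∧ p ∈ N.places) := by
    constructor
    · rintro ⟨⟨h1, -⟩, h2⟩
      exact ⟨h1, (Finset.mem_inter.mp h2).1⟩
    · rintro ⟨h1, h2⟩
      have hF : N.F p r := h1.resolve_right fun h => Finset.disjoint_left.mp N.disj h2 h.1
      have hS : p ∈ S := E.place_mem hr h2 (Or.inl hF)
      exact ⟨⟨h1, hS⟩, Finset.mem_inter.mpr ⟨h2, hS⟩⟩
  simp only [clusterMarking, this]

end Exhaustion

theorem clusterMarking_freeChoiceCluster {r : α} (hr : r ∈ N.transitions) (p : α) :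
    N.clusterMarking (N.freeChoiceCluster r) p = if N.F p r then 1 else 0 := by
  have : (p ∈ N.freeChoiceCluster r ∧ p ∈ N.places) ↔ N.F p r :=
    ⟨fun ⟨h1, h2⟩ => h1.resolve_right fun h => Finset.disjoint_left.mp N.disj h2 h.1,
      fun h => ⟨Or.inl h, place_of_edge_transition h hr⟩⟩
  simp only [clusterMarking, this]

namespace Exhaustion

variable {n : ℕ} {H : Fin (n + 1) → Finset α} {tin : Fin (n + 1) → α} {S : Finset α}

/-- The final T-net marked at the pre-set of `r` is perpetual. -/
theorem perpetual_restrict (E : N.Exhaustion H tin S) {r : α} {K : ℕ} (hr : r ∈ S)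
    (hr' : r ∈ N.transitions)
    (hl : N.Live (N.clusterMarking (N.freeChoiceCluster r)))
    (hb : N.BoundedBy K (N.clusterMarking (N.freeChoiceCluster r)))
    (hq : N.Quiet S (N.clusterMarking (N.freeChoiceCluster r))) :
    (N.restrict S).Perpetual (N.clusterMarking (N.freeChoiceCluster r))
      (N.freeChoiceCluster r ∩ (S : Set α)) := by
  have hlM := E.live_restrict hl hb hq
  refine ⟨hlM, ⟨K, ?_⟩, E.isCluster_restrict hr hr', ?_⟩
  · rintro m ⟨σ, hσ⟩ p hp
    exact hb m (E.restrict_fireSeq.mp hσ).1.reach p (Finset.mem_inter.mp hp).1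
  · rintro m ⟨σ, hσ⟩
    rw [E.restrict_clusterMarking hr]
    obtain ⟨hσN, hσS⟩ := E.restrict_fireSeq.mp hσ
    have hvec : ∀ p ∈ S, p ∈ N.places → ∀ a ∈ S, ∀ b ∈ S, N.F a p → N.F p b →
        (N.clusterMarking (N.freeChoiceCluster r) p : ℤ) =
          m p + ((σ.count r : ℤ) - σ.count a) - ((σ.count r : ℤ) - σ.count b) := by
      intro p hp hp' a ha b hb hap hpb
      have h1 := hσN.state_equation p
      rw [E.flow_of_mem_core
        (fun t _ ht => by simp [List.count_eq_zero_of_not_mem fun h => ht (hσS t h)])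
        hp hp' ha hb hap hpb] at h1
      have h2 : (m p : ℤ) = N.clusterMarking (N.freeChoiceCluster r) p +
          (σ.count a - σ.count b) := by exact_mod_cast h1
      omega
    exact E.reach_restrict_of_vector (y := fun t => (σ.count r : ℤ) - σ.count t)
      (hlM.of_reach hσ.reach)
      (fun t ht ht' => (E.core_vector_bounds hr hr'
        (w := fun t => (σ.count r : ℤ) - σ.count t) (sub_self _)
        (clusterMarking_freeChoiceCluster hr') hvec ht ht').1) hvec

end Exhaustion

end Net

/-- **Propagating enabling equivalence to the final T-net.** Let `(N, μ₀)` be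
a perpetual free-choice system with regeneration cluster `cl`, let `(N̂ᵢ)` be
a `cl`-adapted CP-exhaustion with final strongly connected T-net
`N̄ = N ∖ ⋃ᵢ N̂ᵢ`, let `μ₁, μ₂` be reachable markings with
`en(N,μ₁) = en(N,μ₂)`, and let `σ` be a global shutdown sequence with
`μⱼ →σ→ μ_{j,sd}`. Then `(N̄, μ_cl̄)` with `cl̄ = N̄ ∩ cl` is a perpetual
T-system, the restrictions `μ̄_{j,sd}` are reachable in it, and
`en(N̄, μ̄_{1,sd}) = en(N̄, μ̄_{2,sd})`. -/
theorem global_shutdown_propagates_enabling_equivalence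
    {α : Type*} [DecidableEq α] (N : Net α) (μ₀ : α → ℕ) (cl : Set α)
    (hfc : N.FreeChoice) (hperp : N.Perpetual μ₀ cl)
    (n : ℕ) (Nhat : Fin (n + 1) → Finset α)
    (hex : N.IsCPExhaustion Nhat) (had : ∀ i, ¬ cl ⊆ (Nhat i : Set α))
    (tin : Fin (n + 1) → α) (htin : ∀ i, N.IsWayIn (Nhat i) (tin i))
    (μ₁ μ₂ : α → ℕ) (h₁ : N.Reach μ₀ μ₁) (h₂ : N.Reach μ₀ μ₂)
    (hen : N.en μ₁ = N.en μ₂)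
    (σs : Fin (n + 1) → List α)
    (hsd : ∀ i, (∃ ν, N.IsShutdownSeq (Nhat i) (tin i) μ₁ (σs i) ν) ∧
                (∃ ν, N.IsShutdownSeq (Nhat i) (tin i) μ₂ (σs i) ν))
    (μ₁sd μ₂sd : α → ℕ)
    (hfire₁ : N.FireSeq μ₁ (List.ofFn σs).flatten μ₁sd)
    (hfire₂ : N.FireSeq μ₂ (List.ofFn σs).flatten μ₂sd) :
    (N.restrict (N.nodes \ Finset.univ.biUnion Nhat)).Perpetual
      ((N.restrict (N.nodes \ Finset.univ.biUnion Nhat)).clusterMarking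
        (cl ∩ ((N.nodes \ Finset.univ.biUnion Nhat : Finset α) : Set α)))
      (cl ∩ ((N.nodes \ Finset.univ.biUnion Nhat : Finset α) : Set α)) ∧
    (∃ ν, (N.restrict (N.nodes \ Finset.univ.biUnion Nhat)).Reach
        ((N.restrict (N.nodes \ Finset.univ.biUnion Nhat)).clusterMarking
          (cl ∩ ((N.nodes \ Finset.univ.biUnion Nhat : Finset α) : Set α))) ν ∧
      (N.restrict (N.nodes \ Finset.univ.biUnion Nhat)).MarkingEq ν μ₁sd) ∧
    (∃ ν, (N.restrict (N.nodes \ Finset.univ.biUnion Nhat)).Reach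
        ((N.restrict (N.nodes \ Finset.univ.biUnion Nhat)).clusterMarking
          (cl ∩ ((N.nodes \ Finset.univ.biUnion Nhat : Finset α) : Set α))) ν ∧
      (N.restrict (N.nodes \ Finset.univ.biUnion Nhat)).MarkingEq ν μ₂sd) ∧
    (N.restrict (N.nodes \ Finset.univ.biUnion Nhat)).en μ₁sd =
      (N.restrict (N.nodes \ Finset.univ.biUnion Nhat)).en μ₂sd := by
  set S := N.nodes \ Finset.univ.biUnion Nhat with hS
  have E : N.Exhaustion Nhat tin S :=
    { fc := hfc
      cover := fun x hx => by
        by_cases h : ∃ i, x ∈ Nhat i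
        · exact Or.inr h
        · exact Or.inl (by simpa [hS, hx] using h)
      notMem := fun i x hx hxS => (Finset.mem_sdiff.mp hxS).2
        (Finset.mem_biUnion.mpr ⟨i, Finset.mem_univ i, hx⟩)
      disj := hex.2.1
      wc := fun i => (hex.1 i).2.2.1
      bordered := fun i => (hex.1 i).2.2.2.1
      tnet := fun i => (hex.1 i).2.2.2.2.1
      sc := hex.2.2.1
      tnetS := hex.2.2.2
      wayIn := htin }
  obtain ⟨hlive, ⟨K, hK⟩, hcl, hhome⟩ := hperp
  obtain ⟨r, hr, hr', rfl⟩ := E.exists_cluster_transition hcl had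
  rw [E.restrict_clusterMarking hr]
  set c := N.clusterMarking (N.freeChoiceCluster r) with hcdef
  have hc : ∀ p, c p = if N.F p r then 1 else 0 := N.clusterMarking_freeChoiceCluster hr'
  have hr₁ := h₁.trans hfire₁.reach
  have hr₂ := h₂.trans hfire₂.reach
  have hq₁ := E.quiet_of_shutdown (fun i => (hsd i).1) hfire₁
  have hq₂ := E.quiet_of_shutdown (fun i => (hsd i).2) hfire₂
  have hl₁ := hlive.of_reach hr₁
  have hl₂ := hlive.of_reach hr₂
  have hb₀ : N.BoundedBy K μ₀ := hK
  have hb₁ := hb₀.of_reach hr₁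
  have hb₂ := hb₀.of_reach hr₂
  have hqc : ∀ ν, N.MarkingEq ν c → N.Quiet S ν := by
    intro ν hν t ht hen
    have hnot := hq₁ t ht
    simp only [Net.Enabled, ht.1, true_and, not_forall] at hnot
    obtain ⟨p, hp, -⟩ := hnot
    have hp' := Net.place_of_edge_transition hp ht.1
    have hpos := hen.2 p hp
    rw [hν p hp', hc p] at hpos
    have hpr : N.F p r := by
      by_contra h
      simp [h] at hpos
    exact ht.2.2 p hp (E.place_mem hr hp' (Or.inl hpr))
  have hvector : ∀ m, N.Live m → N.BoundedBy K m → N.Quiet S m → N.Reach μ₀ m →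
      ∃ w : α → ℤ, w r = 0 ∧ ∀ p ∈ S, p ∈ N.places → ∀ a ∈ S, ∀ b ∈ S, N.F a p → N.F p b →
        (c p : ℤ) = m p + w a - w b := by
    intro m hl hb hq hrm
    obtain ⟨ν, hν, hνc⟩ := hhome m hrm
    obtain ⟨w, hw, h⟩ := E.exists_core_vector hl hb hq (hqc ν hνc) hν hr hr'
    exact ⟨w, hw, fun p hp hp' a ha b hb hap hpb =>
      hνc p hp' ▸ h p hp hp' a ha b hb hap hpb⟩
  obtain ⟨w₁, hw₁, hvec₁⟩ := hvector _ hl₁ hb₁ hq₁ hr₁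
  obtain ⟨w₂, hw₂, hvec₂⟩ := hvector _ hl₂ hb₂ hq₂ hr₂
  obtain ⟨ν, hν, hνc⟩ := hhome _ hr₁
  have hperpM := E.perpetual_restrict hr hr' ((hl₁.of_reach hν).congr hνc)
    ((hb₁.of_reach hν).congr hνc) (hqc c fun _ _ => rfl)
  have hreach : ∀ (m : α → ℕ) (w : α → ℤ), w r = 0 →
      (∀ p ∈ S, p ∈ N.places → ∀ a ∈ S, ∀ b ∈ S, N.F a p → N.F p b →
        (c p : ℤ) = m p + w a - w b) →
      ∃ ν, (N.restrict S).Reach c ν ∧ (N.restrict S).MarkingEq ν m := by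
    intro m w hw hvec
    refine E.reach_restrict_of_vector (y := fun t => 1 - w t) hperpM.1 (fun t ht ht' => ?_) ?_
    · have := (E.core_vector_bounds hr hr' hw hc hvec ht ht').2
      omega
    · intro p hp hp' a ha b hb hap hpb
      have := hvec p hp hp' a ha b hb hap hpb
      omega
  refine ⟨hperpM, hreach _ _ hw₁ hvec₁, hreach _ _ hw₂ hvec₂, ?_⟩
  have hinner : ∀ t ∈ (List.ofFn σs).flatten, N.Inner S t := by
    intro t ht
    obtain ⟨l, hl, htl⟩ := List.mem_flatten.mp ht
    obtain ⟨i, rfl⟩ := List.mem_ofFn.mp hl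
    obtain ⟨ν, -, hν, -⟩ := (hsd i).1
    obtain ⟨h1, h2, h3⟩ := hν t htl
    exact E.inner_of_ne_tin hl₁ hb₁ hq₁ h1 h2 h3
  have hflow : ∀ p ∈ S, 0 ≤ N.flow (fun t => ((List.ofFn σs).flatten.count t : ℚ)) p :=
    fun p hp => Net.flow_nonneg (fun t => Nat.cast_nonneg _)
      (fun t ht => hinner t (by
        by_contra h
        exact ht (by simp only [List.count_eq_zero_of_not_mem h, Nat.cast_zero]))) hp
  have hge₁ : ∀ p ∈ S, μ₁ p ≤ μ₁sd p := fun p hp => by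
    have := hfire₁.state_equation p
    have := hflow p hp
    have : (μ₁ p : ℚ) ≤ μ₁sd p := by linarith
    exact_mod_cast this
  have hge₂ : ∀ p ∈ S, μ₂ p ≤ μ₂sd p := fun p hp => by
    have := hfire₂.state_equation p
    have := hflow p hp
    have : (μ₂ p : ℚ) ≤ μ₂sd p := by linarith
    exact_mod_cast this
  have hd : ∀ p, (μ₁sd p : ℤ) - μ₁ p = μ₂sd p - μ₂ p := fun p => by
    have e1 := hfire₁.state_equation p
    have e2 := hfire₂.state_equation p
    have : (μ₁sd p : ℚ) - μ₁ p = μ₂sd p - μ₂ p := by linarith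
    exact_mod_cast this
  have hw : ∀ t ∈ S, t ∈ N.transitions → w₁ t = w₂ t := fun t ht ht' => le_antisymm
    (E.core_vector_le hr hr' hw₁ hw₂ hc hvec₁ hvec₂ (E.live_restrict hl₁ hb₁ hq₁) hen hd
      hge₂ ht ht')
    (E.core_vector_le hr hr' hw₂ hw₁ hc hvec₂ hvec₁ (E.live_restrict hl₂ hb₂ hq₂) hen.symm
      (fun p => (hd p).symm) hge₁ ht ht')
  have heq : (N.restrict S).MarkingEq μ₁sd μ₂sd := by
    intro p hp
    obtain ⟨hp', hp⟩ := Finset.mem_inter.mp hp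
    obtain ⟨⟨a, ⟨ha, hap⟩, -⟩, ⟨b, ⟨hb, hpb⟩, -⟩⟩ := E.tnetS p hp hp'
    have e1 := hvec₁ p hp hp' a ha b hb hap hpb
    have e2 := hvec₂ p hp hp' a ha b hb hap hpb
    rw [hw a ha (Net.transition_of_edge_place hap hp'),
      hw b hb (Net.transition_of_place_edge hpb hp')] at e1
    omega
  exact Set.ext fun t => ⟨fun h => heq.enabled h, fun h => heq.symm.enabled h⟩
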